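/- arXiv:math/0703867 — 3 statements merged into one kernel-verified Lean document; each statement's English description precedes it below -/
import Mathlib

section
/- Let A be a two-element set (k = 2) and let B_0 ⊂ B_1 ⊂ B_2 be the chain of all clones on A containing all unary operations. For each 0 ≤ i ≤ 2, there exists an infinite set of pairwise B_i-incomparable operations on A if and only if i ≤ 1. -/
namespace PaperSubfn

/-- A finitary operation on `A`: an arity `n` together with a map `(Fin n → A) → A`. -/
abbrev Op (A : Type*) := Σ n : ℕ, (Fin n → A) → A

variable {A : Type*}

/-- `f` is a `C`-subfunction of `g`: `f = g(h₁, …, h_m)` with all `h_i ∈ C`. -/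
def Subfn (C : Set (Op A)) (f g : Op A) : Prop :=
  ∃ h : Fin g.1 → ((Fin f.1 → A) → A),
    (∀ i, (⟨f.1, h i⟩ : Op A) ∈ C) ∧ ∀ a, f.2 a = g.2 fun i => h i a

/-- `f` and `g` are `C`-equivalent. -/
def EquivC (C : Set (Op A)) (f g : Op A) : Prop :=
  Subfn C f g ∧ Subfn C g f

/-- `f` is a proper `C`-subfunction of `g`. -/
def ProperSubfn (C : Set (Op A)) (f g : Op A) : Prop :=
  Subfn C f g ∧ ¬ Subfn C g f

/-- `f` and `g` are `C`-incomparable. -/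
def Incomp (C : Set (Op A)) (f g : Op A) : Prop :=
  ¬ Subfn C f g ∧ ¬ Subfn C g f

/-- The `n`-ary `i`-th projection. -/
def proj (A : Type*) (n : ℕ) (i : Fin n) : Op A := ⟨n, fun a => a i⟩

/-- `C` is closed under functional composition. -/
def ClosedComp (C : Set (Op A)) : Prop :=
  ∀ (n m : ℕ) (f : (Fin n → A) → A) (g : Fin n → (Fin m → A) → A),
    (⟨n, f⟩ : Op A) ∈ C → (∀ i, (⟨m, g i⟩ : Op A) ∈ C) →
      (⟨m, fun a => f fun i => g i a⟩ : Op A) ∈ C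

/-- A clone: contains all projections and is closed under composition. -/
def IsClone (C : Set (Op A)) : Prop :=
  (∀ n i, proj A n i ∈ C) ∧ ClosedComp C

/-- The clone generated by a set of operations. -/
def cloneGen (S : Set (Op A)) : Set (Op A) :=
  ⋂₀ {C : Set (Op A) | IsClone C ∧ S ⊆ C}

/-- The `i`-th variable is essential in `f`. -/
def essAt {n : ℕ} (f : (Fin n → A) → A) (i : Fin n) : Prop :=
  ∃ a b : Fin n → A, (∀ j, j ≠ i → a j = b j) ∧ f a ≠ f b

/-- The set of essential variables. -/
def essSet {n : ℕ} (f : (Fin n → A) → A) : Set (Fin n) := {i | essAt f i}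

/-- The essential arity of an operation. -/
noncomputable def essArity (f : Op A) : ℕ := (essSet f.2).ncard

/-- `f` is essentially at most unary. -/
def EssUnary (f : Op A) : Prop := (essSet f.2).Subsingleton

/-- The range of an operation. -/
def rng (f : Op A) : Set A := Set.range f.2

/-- Quasilinear operations: `f = g(h₁(x₁) ⊕ ⋯ ⊕ h_n(x_n))`. -/
def Quasilinear (f : Op A) : Prop :=
  ∃ (h : Fin f.1 → A → ZMod 2) (g : ZMod 2 → A),
    ∀ a, f.2 a = g (∑ i, h i (a i))

/-- The class of all unary operations. -/
def unaries (A : Type*) : Set (Op A) := {f : Op A | f.1 = 1}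

/-- The chain of clones `B_0 ⊂ B_1 ⊂ ⋯ ⊂ B_k` containing all unary operations. -/
def B (A : Type*) : ℕ → Set (Op A)
  | 0 => cloneGen (unaries A)
  | 1 => {f : Op A | EssUnary f ∨ Quasilinear f}
  | (i + 2) => {f : Op A | EssUnary f ∨ (rng f).ncard ≤ i + 2}

def PP {n : ℕ} (f : (Fin n → Fin 2) → Fin 2) : Prop :=
  ∀ x y z, f (x + y + z) = f x + f y + f z

lemma un_PP (g : Fin 2 → Fin 2) : ∀ x y z, g (x + y + z) = g x + g y + g z := by
  revert g; decide

lemma agree_ess {n : ℕ} (f : (Fin n → Fin 2) → Fin 2) (a b : Fin n → Fin 2)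
    (h : ∀ i, essAt f i → a i = b i) : f a = f b := by
  classical
  have key : ∀ T : Finset (Fin n), f (fun i => if i ∈ T then b i else a i) = f a := by
    intro T
    induction T using Finset.induction_on with
    | empty => simp
    | insert j T hj ih =>
      rw [← ih]
      by_cases he : essAt f j
      · congr 1
        funext i
        by_cases hij : i = j
        · subst hij; simp [hj, h i he]
        · simp [hij]
      · by_contra hne
        exact he ⟨_, _, fun i hi => by simp [hi], hne⟩
  have := key Finset.univ
  simpa using this.symm

lemma essUnary_PP {n : ℕ} (f : (Fin n → Fin 2) → Fin 2) (h : EssUnary (⟨n, f⟩ : Op (Fin 2))) :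
    PP f := by
  intro x y z
  have key : ∃ i : Option (Fin n), ∀ j, essAt f j → some j = i := by
    by_cases hne : ∃ j, essAt f j
    · obtain ⟨j, hj⟩ := hne
      exact ⟨some j, fun k hk => congrArg some (h hk hj)⟩
    · exact ⟨none, fun k hk => (hne ⟨k, hk⟩).elim⟩
  obtain ⟨i, hi⟩ := key
  have self (c : Fin 2) : c + c = 0 := by revert c; decide
  cases i with
  | none =>
    have e : ∀ a b, f a = f b := fun a b => agree_ess f a b (fun j hj => by simpa using hi j hj)
    rw [e (x + y + z) z, e x z, e y z, self, zero_add]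
  | some i =>
    have e : ∀ a b, a i = b i → f a = f b := fun a b hab => agree_ess f a b (fun j hj => by
      have := hi j hj
      simp only [Option.some.injEq] at this
      rw [this]; exact hab)
    have tri : x i = y i ∨ y i = z i ∨ x i = z i := by
      generalize x i = p; generalize y i = q; generalize z i = r
      revert p q r; decide
    rcases tri with t | t | t
    · rw [e (x + y + z) z (by simp [t, self]), e x y t, self, zero_add]
    · rw [e (x + y + z) x (by simp [t, self, add_assoc]), e y z t, add_assoc, self, add_zero]
    · rw [e (x + y + z) y (by simp [t]; rw [add_right_comm, self, zero_add]), e x z t, add_right_comm,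
        self, zero_add]

lemma quasi_PP {n : ℕ} (f : (Fin n → Fin 2) → Fin 2) (h : Quasilinear (⟨n, f⟩ : Op (Fin 2))) :
    PP f := by
  obtain ⟨h, g, hg⟩ := h
  intro x y z
  have h1 := hg (x + y + z)
  have h2 := hg x
  have h3 := hg y
  have h4 := hg z
  simp only at h1 h2 h3 h4
  rw [h1, h2, h3, h4]
  have : ∀ i, h i ((x + y + z) i) = h i (x i) + h i (y i) + h i (z i) := fun i =>
    un_PP (h i) _ _ _
  simp only [this, Finset.sum_add_distrib]
  exact un_PP g _ _ _

lemma B1_PP (f : Op (Fin 2)) (h : f ∈ B (Fin 2) 1) : PP f.2 := by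
  rcases h with h | h
  · exact essUnary_PP f.2 h
  · exact quasi_PP f.2 h

lemma B0_PP (f : Op (Fin 2)) (h : f ∈ B (Fin 2) 0) : PP f.2 := by
  have := h {f : Op (Fin 2) | PP f.2} ⟨⟨?_, ?_⟩, ?_⟩
  · exact this
  · intro n i x y z; rfl
  · intro n m f g hf hg x y z
    have : (fun i => g i (x + y + z)) = (fun i => g i x) + (fun i => g i y) + (fun i => g i z) := by
      funext i; exact hg i x y z
    show f _ = _
    rw [this]
    exact hf _ _ _
  · rintro ⟨n, f⟩ hn
    obtain rfl : n = 1 := hn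
    exact essUnary_PP f (fun a _ b _ => Subsingleton.elim a b)

def sv (n : ℕ) : Option (Fin n) → (Fin n → Fin 2)
  | none => fun _ => 1
  | some i => Pi.single i 1

lemma circuit {n : ℕ} (T : Finset (Option (Fin n))) (h : ∑ t ∈ T, sv n t = 0) (hT : T.Nonempty) :
    T = Finset.univ := by
  classical
  have key : ∀ i, none ∈ T ↔ some i ∈ T := by
    intro i
    have h1 := congrFun h i
    rw [Finset.sum_apply] at h1
    have h2 : ∑ t ∈ T, sv n t i = ∑ t : Option (Fin n), if t ∈ T then sv n t i else 0 := by
      rw [Finset.sum_ite_mem, Finset.univ_inter]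
    rw [h2, Fintype.sum_option, Finset.sum_eq_single i] at h1
    · by_cases a : none ∈ T <;> by_cases b : some i ∈ T <;> simp_all [sv]
    · intro j _ hj
      simp [sv, Pi.single_apply, hj.symm]
    · simp
  ext t
  simp only [Finset.mem_univ, iff_true]
  obtain ⟨u, hu⟩ := hT
  have hn : none ∈ T := by
    cases u with
    | none => exact hu
    | some j => exact (key j).2 hu
  cases t with
  | none => exact hn
  | some j => exact (key j).1 hn

lemma self2 {n : ℕ} (v : Fin n → Fin 2) : v + v = 0 := by
  funext i
  have self (c : Fin 2) : c + c = 0 := by revert c; decide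
  exact self _

lemma circuit_card {n : ℕ} (T : Finset (Option (Fin n))) (h : ∑ t ∈ T, sv n t = 0)
    (hT : T.Nonempty) : T.card = n + 1 := by
  rw [circuit T h hT]; simp

lemma sv_inj {n : ℕ} (hn : 5 ≤ n) : Function.Injective (sv n) := by
  classical
  intro x y h
  by_contra hne
  have := circuit_card {x, y} (by rw [Finset.sum_pair hne, h, self2]) (by simp)
  have := Finset.card_le_two (a := x) (b := y)
  omega

lemma sv_triple {n : ℕ} (hn : 5 ≤ n) {x y : Option (Fin n)} (hxy : x ≠ y) :
    ∃ z, sv n x + sv n y + sv n z ∉ Set.range (sv n) := by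
  classical
  obtain ⟨z, hz⟩ : ∃ z, z ∉ ({x, y} : Finset (Option (Fin n))) := by
    by_contra! hc
    have h1 : ({x, y} : Finset (Option (Fin n))) = Finset.univ := by ext; simp [hc]
    have h2 := congrArg Finset.card h1
    have := Finset.card_le_two (a := x) (b := y)
    simp at h2
    omega
  simp only [Finset.mem_insert, Finset.mem_singleton, not_or] at hz
  obtain ⟨hzx, hzy⟩ := hz
  refine ⟨z, ?_⟩
  rintro ⟨w, hw⟩
  have hs : sv n x + sv n y + sv n z + sv n w = 0 := by rw [← hw, self2]
  have inj := sv_inj hn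
  by_cases hwx : w = x
  · subst hwx
    have : sv n y + sv n z = 0 := by
      have e : sv n w + sv n y + sv n z + sv n w = (sv n w + sv n w) + (sv n y + sv n z) := by abel
      rw [e, self2, zero_add] at hs; exact hs
    have : sv n y = sv n z := by
      rw [← add_right_cancel_iff (a := sv n z), this, self2]
    exact hzy (inj this).symm
  by_cases hwy : w = y
  · subst hwy
    have : sv n x + sv n z = 0 := by
      have e : sv n x + sv n w + sv n z + sv n w = (sv n w + sv n w) + (sv n x + sv n z) := by abel
      rw [e, self2, zero_add] at hs; exact hs
    have : sv n x = sv n z := by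
      rw [← add_right_cancel_iff (a := sv n z), this, self2]
    exact hzx (inj this).symm
  by_cases hwz : w = z
  · subst hwz
    have : sv n x + sv n y = 0 := by
      rw [add_assoc, self2, add_zero] at hs; exact hs
    have : sv n x = sv n y := by
      rw [← add_right_cancel_iff (a := sv n y), this, self2]
    exact hxy (inj this)
  have hT : ∑ t ∈ ({x, y, z, w} : Finset (Option (Fin n))), sv n t = 0 := by
    rw [Finset.sum_insert (by simp [hxy, Ne.symm hzx, Ne.symm hwx]),
      Finset.sum_insert (by simp [Ne.symm hzy, Ne.symm hwy]),
      Finset.sum_pair (Ne.symm hwz), ← hs]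
    abel
  have h1 := circuit_card _ hT (by simp)
  have := Finset.card_le_four (a := x) (b := y) (c := z) (d := w)
  omega

open Classical in
noncomputable def ff (n : ℕ) : Op (Fin 2) := ⟨n, fun x => if x ∈ Set.range (sv n) then 1 else 0⟩

lemma main_ff (C : Set (Op (Fin 2))) (hC : ∀ f ∈ C, PP f.2) {m n : ℕ} (hm : 5 ≤ m) (hn : 5 ≤ n)
    (hodd : Odd m) (hs : Subfn C (ff m) (ff n)) : m = n := by
  classical
  obtain ⟨h, hhC, hh⟩ := hs
  have hP : ∀ i, PP (h i) := fun i => hC _ (hhC i)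
  obtain ⟨φ, hφ⟩ : ∃ φ : (Fin m → Fin 2) → (Fin n → Fin 2), φ = fun a i => h i a := ⟨_, rfl⟩
  have φP : ∀ x y z, φ (x + y + z) = φ x + φ y + φ z := by
    intro x y z
    subst hφ
    funext i
    exact hP i x y z
  have hr : ∀ a, a ∈ Set.range (sv m) ↔ φ a ∈ Set.range (sv n) := by
    intro a
    have h0 : (if a ∈ Set.range (sv m) then (1 : Fin 2) else 0)
        = if φ a ∈ Set.range (sv n) then 1 else 0 := by
      subst hφ; exact hh a
    by_cases p : a ∈ Set.range (sv m) <;> by_cases q : φ a ∈ Set.range (sv n) <;>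
      simp only [p, q, if_true, if_false] at h0 ⊢ <;> exact absurd h0 (by decide)
  have hσ : ∀ t, ∃ u, sv n u = φ (sv m t) := fun t => (hr _).1 ⟨t, rfl⟩
  choose σ hσ using hσ
  have σinj : Function.Injective σ := by
    intro x y hxy
    by_contra hne
    obtain ⟨z, hz⟩ := sv_triple hm hne
    apply hz
    rw [hr, φP, ← hσ x, ← hσ y, hxy, self2, zero_add, ← hσ z]
    exact ⟨_, rfl⟩
  let ψ : (Fin m → Fin 2) →+ (Fin n → Fin 2) :=
    { toFun := fun x => φ x + φ 0
      map_zero' := self2 _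
      map_add' := fun x y => by
        have := φP x y 0
        rw [add_zero] at this
        rw [this]
        have e : φ x + φ 0 + (φ y + φ 0) = φ x + φ y + φ 0 + φ 0 := by abel
        rw [e] }
  have hψ : ∀ x, φ x = ψ x + φ 0 := by
    intro x
    show φ x = φ x + φ 0 + φ 0
    rw [add_assoc, self2, add_zero]
  have hsum0 : ∑ t, sv m t = 0 := by
    rw [Fintype.sum_option]
    have : ∑ i, sv m (some i) = fun _ => 1 := Finset.univ_sum_single (fun _ : Fin m => (1 : Fin 2))
    rw [this]
    exact self2 _
  have hsum : ∑ t, φ (sv m t) = 0 := by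
    simp only [hψ (sv m _)]
    rw [Finset.sum_add_distrib, ← map_sum, hsum0, map_zero, zero_add]
    obtain ⟨k, rfl⟩ := hodd
    simp only [Finset.sum_const, Finset.card_univ, Fintype.card_option, Fintype.card_fin]
    rw [show 2 * k + 1 + 1 = (k + 1) * 2 by ring, mul_nsmul', two_nsmul, self2]
    simp
  have himg : ∑ t ∈ Finset.univ.image σ, sv n t = 0 := by
    rw [Finset.sum_image (fun a _ b _ hab => σinj hab), ← hsum]
    exact Finset.sum_congr rfl (fun t _ => hσ t)
  have hc := circuit_card _ himg (by simp)
  rw [Finset.card_image_of_injective _ σinj] at hc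
  simpa using hc

lemma antichain (C : Set (Op (Fin 2))) (hC : ∀ f ∈ C, PP f.2) :
    ∃ S : Set (Op (Fin 2)), S.Infinite ∧ S.Pairwise (Incomp C) := by
  have odd : ∀ k, Odd (2 * k + 5) := fun k => ⟨k + 2, by ring⟩
  refine ⟨Set.range fun k : ℕ => ff (2 * k + 5), Set.infinite_range_of_injective ?_, ?_⟩
  · intro a b hab
    have : 2 * a + 5 = 2 * b + 5 := congrArg Sigma.fst hab
    omega
  · rintro _ ⟨a, rfl⟩ _ ⟨b, rfl⟩ hne
    refine ⟨fun h => hne ?_, fun h => hne ?_⟩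
    · have := main_ff C hC (by omega) (by omega) (odd a) h
      simp only [this]
    · have := main_ff C hC (by omega) (by omega) (odd b) h
      simp only [this]

lemma no_antichain (S : Set (Op (Fin 2))) (hS : S.Infinite)
    (hP : S.Pairwise (Incomp (B (Fin 2) 2))) : False := by
  obtain ⟨f, hf, g, hg, hne, he⟩ := hS.exists_ne_map_eq_of_mapsTo (f := rng)
    (t := Set.univ) (fun _ _ => Set.mem_univ _) Set.finite_univ
  apply (hP hf hg hne).1
  have : ∀ a, ∃ b, g.2 b = f.2 a := fun a => by
    have : f.2 a ∈ rng f := ⟨a, rfl⟩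
    rw [he] at this
    exact this
  choose u hu using this
  refine ⟨fun i a => u a i, fun i => Or.inr ?_, fun a => (hu a).symm⟩
  refine (Set.ncard_le_ncard (Set.subset_univ _) Set.finite_univ).trans ?_
  simp [Set.ncard_univ]

/-- Main theorem, part (iii): for a two-element base set, there is an infinite
antichain of pairwise `B_i`-incomparable operations iff `i ≤ 1`. -/
theorem infinite_antichain_iff_two_element (i : ℕ) (hik : i ≤ 2) :
    (∃ S : Set (Op (Fin 2)), S.Infinite ∧ S.Pairwise (Incomp (B (Fin 2) i))) ↔
      i ≤ 1 := by
  constructor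
  · rintro ⟨S, hS, hP⟩
    by_contra hi
    obtain rfl : i = 2 := by omega
    exact no_antichain S hS hP
  · intro hi
    interval_cases i
    · exact antichain _ B0_PP
    · exact antichain _ B1_PP

end PaperSubfn
end

section
/- For any transformation monoid M on a finite set A, there is no infinite descending chain of ⟨M⟩-subfunctions; that is, there is no infinite sequence (f_n) of operations on A such that f_{n+1} is a proper ⟨M⟩-subfunction of f_n for every n. -/
namespace PaperSubfn

variable {A : Type*}

/-- The clone generated by a transformation monoid `M` (a set of unary maps
containing the identity and closed under composition). -/
def monoidClone {A : Type*} (M : Set (A → A)) : Set (Op A) :=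
  cloneGen {f : Op A | ∃ m ∈ M, f = ⟨1, fun a => m (a 0)⟩}

theorem monoidClone_isClone (M : Set (A → A)) : IsClone (monoidClone M) := by
  refine ⟨fun n i C hC => hC.1.1 n i, ?_⟩
  intro n m f g hf hg C hC
  exact hC.1.2 n m f g (hf C hC) (fun i => hg i C hC)

theorem monoidClone_rep (M : Set (A → A)) (f : Op A) (hf : f ∈ monoidClone M) :
    ∃ (j : Fin f.1) (m : A → A), ∀ a, f.2 a = m (a j) := by
  have := hf {f : Op A | ∃ (j : Fin f.1) (m : A → A), ∀ a, f.2 a = m (a j)} ?_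
  · exact this
  · refine ⟨⟨fun n i => ⟨i, id, fun a => rfl⟩, ?_⟩, ?_⟩
    · rintro n m f g ⟨j, u, hu⟩ hg
      obtain ⟨k, v, hv⟩ := hg j
      refine ⟨k, u ∘ v, fun a => ?_⟩
      have h1 := hu (fun i => g i a)
      have h2 := hv a
      simp only at h1 h2 ⊢
      rw [h1, h2]
      rfl
    · rintro f ⟨m, _, rfl⟩
      exact ⟨0, m, fun a => rfl⟩

theorem Subfn.trans' {C : Set (Op A)} (hC : IsClone C) {f g k : Op A}
    (h1 : Subfn C f g) (h2 : Subfn C g k) : Subfn C f k := by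
  obtain ⟨u, hu, hu'⟩ := h1
  obtain ⟨v, hv, hv'⟩ := h2
  refine ⟨fun i a => v i fun l => u l a, fun i => hC.2 _ _ _ _ (hv i) hu, fun a => ?_⟩
  rw [hu', hv']

theorem Subfn.refl' {C : Set (Op A)} (hC : IsClone C) (f : Op A) : Subfn C f f :=
  ⟨fun i a => a i, fun i => hC.1 _ i, fun _ => rfl⟩

theorem subfn_equiv_fixed (M : Set (A → A)) {f g : Op A} (hg : 0 < g.1)
    (h : Subfn (monoidClone M) f g) :
    ∃ k : (Fin g.1 → A) → A, Subfn (monoidClone M) f ⟨g.1, k⟩ ∧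
      Subfn (monoidClone M) ⟨g.1, k⟩ f := by
  obtain ⟨u, hu, hu'⟩ := h
  choose σ m hm using fun i => monoidClone_rep M _ (hu i)
  haveI : Nonempty (Fin g.1) := ⟨⟨0, hg⟩⟩
  have hC := monoidClone_isClone M
  let τ : Fin f.1 → Fin g.1 := Function.invFun σ
  refine ⟨fun y => f.2 fun j => y (τ j), ⟨fun i a => a (σ i), fun i => hC.1 _ _, fun a => ?_⟩,
    ⟨fun j y => y (τ j), fun i => hC.1 _ _, fun _ => rfl⟩⟩
  change f.2 a = f.2 fun j => a (σ (τ j))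
  rw [hu', hu']
  refine congrArg g.2 ?_
  funext i
  have h1 := hm i a
  have h2 := hm i (fun j => a (σ (τ j)))
  simp only at h1 h2
  rw [h1, h2]
  have : σ (τ (σ i)) = σ i := Function.invFun_eq ⟨i, rfl⟩
  rw [this]

/-- For a transformation monoid `M` on a finite set, there is no infinite
descending chain of `⟨M⟩`-subfunctions. -/
theorem no_infinite_descending_chain_monoidClone (A : Type*) [Finite A]
    (M : Set (A → A)) (hid : id ∈ M) (hcomp : ∀ u ∈ M, ∀ v ∈ M, u ∘ v ∈ M) :
    ¬ ∃ f : ℕ → Op A, ∀ n : ℕ, ProperSubfn (monoidClone M) (f (n + 1)) (f n) := by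
  rintro ⟨f, hf⟩
  have hC := monoidClone_isClone M
  have hle : ∀ s d, Subfn (monoidClone M) (f (s + d)) (f s) := by
    intro s d
    induction d with
    | zero => exact Subfn.refl' hC _
    | succ d ih => exact Subfn.trans' hC (hf (s + d)).1 ih
  by_cases h0 : ∃ s, 0 < (f s).1
  · obtain ⟨s, hs⟩ := h0
    choose k hk1 hk2 using fun d => subfn_equiv_fixed M hs (hle s d)
    have key : ∀ i j, i < j → k i ≠ k j := by
      intro i j hij he
      obtain ⟨d, rfl⟩ := Nat.exists_eq_add_of_lt hij
      apply (hf (s + i)).2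
      have h1 := hk1 i
      rw [he] at h1
      have h2 := hle (s + i + 1) d
      have e : s + i + 1 + d = s + (i + d + 1) := by omega
      rw [e] at h2
      exact Subfn.trans' hC (Subfn.trans' hC h1 (hk2 _)) h2
    obtain ⟨i, j, hij, he⟩ := Finite.exists_ne_map_eq_of_infinite k
    rcases lt_or_gt_of_ne hij with h | h
    · exact key i j h he
    · exact key j i h he.symm
  · push Not at h0
    have e0 : (f 0).1 = 0 := by have := h0 0; omega
    have e1 : (f (0 + 1)).1 = 0 := by have := h0 (0 + 1); omega
    apply (hf 0).2
    obtain ⟨u, _, hu⟩ := (hf 0).1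
    haveI : IsEmpty (Fin (f 0).1) := by rw [e0]; infer_instance
    haveI : IsEmpty (Fin (f (0 + 1)).1) := by rw [e1]; infer_instance
    refine ⟨fun i => isEmptyElim i, fun i => isEmptyElim i, fun a => ?_⟩
    rw [hu]
    refine congrArg (f 0).2 ?_
    exact Subsingleton.elim _ _

end PaperSubfn
end

section
/- Let A be a finite set with k ≥ 2 elements and let B_1 be the clone consisting of all essentially at most unary operations and all quasilinear operations on A. If f ⊑_{B_1} g, deg_{B_1} f = deg_{B_1} g, and deg^r_{B_1} f = deg^r_{B_1} g, then f ≡_{B_1} g. -/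
namespace PaperSubfn

variable {A : Type*}

/-- `(g, φ₁, …, φ_d)` is a `C`-decomposition of `f`: `f = g(φ₁, …, φ_d)` with all
`φ_i ∈ C`. -/
def IsDecomp (C : Set (Op A)) (f : Op A) (d : ℕ)
    (g : (Fin d → A) → A) (φ : Fin d → (Fin f.1 → A) → A) : Prop :=
  (∀ i, (⟨f.1, φ i⟩ : Op A) ∈ C) ∧ ∀ a, f.2 a = g fun i => φ i a

/-- `f` is a constant operation. -/
def IsConstOp (f : Op A) : Prop := ∃ c : A, ∀ a, f.2 a = c

open Classical in
/-- The `C`-degree of `f`: the least number of inner functions over all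
`C`-decompositions of `f` (and `0` for constant operations). -/
noncomputable def degC (C : Set (Op A)) (f : Op A) : ℕ :=
  if IsConstOp f then 0
  else sInf {d : ℕ | ∃ g φ, IsDecomp C f d g φ}

/-- A minimal `C`-decomposition: one with the least possible number of inner
functions. -/
def IsMinDecomp (C : Set (Op A)) (f : Op A) (d : ℕ)
    (g : (Fin d → A) → A) (φ : Fin d → (Fin f.1 → A) → A) : Prop :=
  IsDecomp C f d g φ ∧
  ∀ (d' : ℕ) (g' : (Fin d' → A) → A) (φ' : Fin d' → (Fin f.1 → A) → A),
    IsDecomp C f d' g' φ' → d ≤ d'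

/-- The range of the tuple-valued map `(φ₁, …, φ_d) : Aⁿ → A^d`. -/
def tupleRange {n d : ℕ} (φ : Fin d → (Fin n → A) → A) : Set (Fin d → A) :=
  Set.range fun a : Fin n → A => fun i => φ i a

/-- The `C`-range degree of `f`: the least cardinality of the range of the inner
functions over all minimal `C`-decompositions of `f`. -/
noncomputable def degrC (C : Set (Op A)) (f : Op A) : ℕ :=
  sInf {r : ℕ | ∃ (d : ℕ) (g : (Fin d → A) → A) (φ : Fin d → (Fin f.1 → A) → A),
    IsMinDecomp C f d g φ ∧ (tupleRange φ).ncard = r}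

/-- A tuple `(φ₁, …, φ_d)` (`d ≥ 2`) is functionally dependent if some `φ_i` is a
function of the remaining ones. -/
def FunDep {n d : ℕ} (φ : Fin d → (Fin n → A) → A) : Prop :=
  2 ≤ d ∧ ∃ (i : Fin d) (h : ({j : Fin d // j ≠ i} → A) → A),
    ∀ a, φ i a = h fun j => φ j.1 a

/-- Affine forms `c + ∑ h_l(x_l)` with values in `ZMod 2`. -/
def Aff (A : Type*) (n : ℕ) : Submodule (ZMod 2) ((Fin n → A) → ZMod 2) where
  carrier := {L | ∃ (c : ZMod 2) (h : Fin n → A → ZMod 2), ∀ a, L a = c + ∑ i, h i (a i)}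
  zero_mem' := ⟨0, fun _ _ => 0, fun a => by simp⟩
  add_mem' := by
    rintro x y ⟨c, h, hx⟩ ⟨c', h', hy⟩
    refine ⟨c + c', fun i b => h i b + h' i b, fun a => ?_⟩
    simp only [Pi.add_apply, hx, hy, Finset.sum_add_distrib]
    ring
  smul_mem' := by
    rintro r x ⟨c, h, hx⟩
    refine ⟨r * c, fun i b => r * h i b, fun a => ?_⟩
    simp only [Pi.smul_apply, smul_eq_mul, hx, ← Finset.mul_sum]
    ring

theorem aff_const (n : ℕ) (c : ZMod 2) : (fun _ => c) ∈ Aff A n :=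
  ⟨c, fun _ _ => 0, fun a => by simp⟩

theorem aff_unary {n : ℕ} (l : Fin n) (m : A → ZMod 2) : (fun a => m (a l)) ∈ Aff A n := by
  classical
  refine ⟨0, fun i b => if i = l then m b else 0, fun a => ?_⟩
  simp

theorem zmod2_fun (e : ZMod 2 → ZMod 2) (z : ZMod 2) : e z = e 0 + (e 1 - e 0) * z := by
  have : z = 0 ∨ z = 1 := by revert z; decide
  rcases this with rfl | rfl <;> simp

theorem aff_comp {n : ℕ} (e : ZMod 2 → ZMod 2) {L : (Fin n → A) → ZMod 2} (hL : L ∈ Aff A n) :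
    (fun a => e (L a)) ∈ Aff A n := by
  have : (fun a => e (L a)) = (fun _ => e 0) + (e 1 - e 0) • L := by
    funext a
    simp only [Pi.add_apply, Pi.smul_apply, smul_eq_mul]
    exact zmod2_fun e (L a)
  rw [this]
  exact Submodule.add_mem _ (aff_const n _) (Submodule.smul_mem _ _ hL)

theorem quasi_of_aff {n : ℕ} (g : ZMod 2 → A) {L : (Fin n → A) → ZMod 2} (hL : L ∈ Aff A n) :
    Quasilinear (⟨n, fun a => g (L a)⟩ : Op A) := by
  obtain ⟨c, h, hh⟩ := hL
  exact ⟨h, fun z => g (c + z), fun a => by simp [hh]⟩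

theorem aff_of_quasi {n : ℕ} {φ : (Fin n → A) → A} (h : Quasilinear (⟨n, φ⟩ : Op A)) :
    ∃ (g : ZMod 2 → A) (L : (Fin n → A) → ZMod 2), L ∈ Aff A n ∧ ∀ a, φ a = g (L a) := by
  obtain ⟨h, g, hh⟩ := h
  exact ⟨g, fun a => ∑ i, h i (a i), ⟨0, h, fun a => by simp⟩, hh⟩

theorem eq_of_not_ess {n : ℕ} (φ : (Fin n → A) → A) (a b : Fin n → A)
    (h : ∀ i, a i ≠ b i → ¬ essAt φ i) : φ a = φ b := by
  classical
  have key : ∀ s : Finset (Fin n), φ (fun i => if i ∈ s then b i else a i) = φ a := by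
    intro s
    induction s using Finset.induction_on with
    | empty => simp
    | insert j s hj ih =>
      rw [← ih]
      by_cases hab : a j = b j
      · congr 1
        funext i
        by_cases hi : i = j
        · subst hi; simp [hj, hab]
        · simp [hi]
      · by_contra hne
        refine h j hab ⟨_, _, ?_, hne⟩
        intro i hi
        simp [hi]
  have := key Finset.univ
  simpa using this.symm

theorem essUnary_cases [Nonempty A] {n : ℕ} {φ : (Fin n → A) → A}
    (h : EssUnary (⟨n, φ⟩ : Op A)) :
    (∃ c, ∀ a, φ a = c) ∨ ∃ (l : Fin n) (u : A → A), ∀ a, φ a = u (a l) := by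
  classical
  obtain ⟨a0⟩ := ‹Nonempty A›
  rcases Set.Subsingleton.eq_empty_or_singleton h with h | ⟨l, h⟩
  · left
    refine ⟨φ (fun _ => a0), fun a => eq_of_not_ess φ _ _ ?_⟩
    intro i _ hi
    have : i ∈ essSet φ := hi
    simp only at h
    rw [h] at this
    exact this
  · right
    refine ⟨l, fun x => φ (Function.update (fun _ => a0) l x), fun a => eq_of_not_ess φ _ _ ?_⟩
    intro i hne hi
    have : i ∈ essSet φ := hi
    simp only at h
    rw [h] at this
    have : i = l := this
    subst this
    simp at hne

theorem essUnary_of {n : ℕ} (l : Fin n) (u : A → A) :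
    EssUnary (⟨n, fun a => u (a l)⟩ : Op A) := by
  have : ∀ i, essAt (fun a : Fin n → A => u (a l)) i → i = l := by
    rintro i ⟨a, b, hab, hne⟩
    by_contra hil
    exact hne (by simp only [hab l (Ne.symm hil)])
  intro i hi j hj
  exact (this i hi).trans (this j hj).symm

theorem quasi_const (n : ℕ) (c : A) : Quasilinear (⟨n, fun _ => c⟩ : Op A) :=
  ⟨fun _ _ => 0, fun _ => c, fun _ => rfl⟩

theorem mem_B1 {n : ℕ} {φ : (Fin n → A) → A} :
    (⟨n, φ⟩ : Op A) ∈ B A 1 ↔ EssUnary (⟨n, φ⟩ : Op A) ∨ Quasilinear (⟨n, φ⟩ : Op A) := Iff.rfl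

theorem B1_cases [Nonempty A] {n : ℕ} {φ : (Fin n → A) → A} (h : (⟨n, φ⟩ : Op A) ∈ B A 1) :
    Quasilinear (⟨n, φ⟩ : Op A) ∨ ∃ (l : Fin n) (u : A → A), ∀ a, φ a = u (a l) := by
  rcases h with h | h
  · rcases essUnary_cases h with ⟨c, hc⟩ | h
    · left
      have : φ = fun _ => c := funext hc
      rw [this]
      exact quasi_const n c
    · exact Or.inr h
  · exact Or.inl h

theorem B1_unary {n : ℕ} (l : Fin n) (u : A → A) : (⟨n, fun a => u (a l)⟩ : Op A) ∈ B A 1 :=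
  Or.inl (essUnary_of l u)

theorem B1_aff {n : ℕ} (g : ZMod 2 → A) {L : (Fin n → A) → ZMod 2} (hL : L ∈ Aff A n) :
    (⟨n, fun a => g (L a)⟩ : Op A) ∈ B A 1 := Or.inr (quasi_of_aff g hL)

theorem B1_post [Nonempty A] {n : ℕ} {φ : (Fin n → A) → A} (h : (⟨n, φ⟩ : Op A) ∈ B A 1)
    (w : A → A) : (⟨n, fun a => w (φ a)⟩ : Op A) ∈ B A 1 := by
  rcases B1_cases h with h | ⟨l, u, hu⟩
  · obtain ⟨g, L, hL, hφ⟩ := aff_of_quasi h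
    simp only [hφ]
    exact B1_aff (fun z => w (g z)) hL
  · simp only [hu]
    exact B1_unary l (fun x => w (u x))

theorem aff_post [Nonempty A] {n : ℕ} {φ : (Fin n → A) → A} (h : (⟨n, φ⟩ : Op A) ∈ B A 1)
    (m : A → ZMod 2) : (fun a => m (φ a)) ∈ Aff A n := by
  rcases B1_cases h with h | ⟨l, u, hu⟩
  · obtain ⟨g, L, hL, hφ⟩ := aff_of_quasi h
    simp only [hφ]
    exact aff_comp (fun z => m (g z)) hL
  · simp only [hu]
    exact aff_unary l (fun x => m (u x))

theorem aff_sum {n : ℕ} {ι : Type*} (s : Finset ι) (F : ι → (Fin n → A) → ZMod 2)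
    (h : ∀ i ∈ s, F i ∈ Aff A n) : (fun a => ∑ i ∈ s, F i a) ∈ Aff A n := by
  have : (fun a => ∑ i ∈ s, F i a) = ∑ i ∈ s, F i := by
    funext a; simp
  rw [this]
  exact Submodule.sum_mem _ h

theorem B1_comp [Nonempty A] {n m : ℕ} {φ : (Fin n → A) → A} {h : Fin n → (Fin m → A) → A}
    (hφ : (⟨n, φ⟩ : Op A) ∈ B A 1) (hh : ∀ i, (⟨m, h i⟩ : Op A) ∈ B A 1) :
    (⟨m, fun a => φ fun i => h i a⟩ : Op A) ∈ B A 1 := by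
  rcases B1_cases hφ with ⟨p, g, hq⟩ | ⟨l, u, hu⟩
  · simp only at hq
    simp only [hq]
    exact B1_aff g (aff_sum Finset.univ (fun i a => p i (h i a)) (fun i _ => aff_post (hh i) (p i)))
  · simp only [hu]
    exact B1_post (hh l) u

/-- A member of `B_1` with range inside that of `g : ZMod 2 → A` is `g` of an affine form. -/
theorem aff_lift [Nonempty A] {n : ℕ} {φ : (Fin n → A) → A} (h : (⟨n, φ⟩ : Op A) ∈ B A 1)
    (g : ZMod 2 → A) (hg : ∀ a, ∃ z, g z = φ a) : ∃ L ∈ Aff A n, ∀ a, φ a = g (L a) := by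
  refine ⟨fun a => Function.invFun g (φ a), aff_post h _, fun a => ?_⟩
  exact (Function.invFun_eq (hg a)).symm

/-- Spanning form of Rado's theorem. -/
theorem rado {L V : Type*} [Fintype L] [DecidableEq L] [AddCommGroup V] [DecidableEq V]
    [Module (ZMod 2) V]
    [FiniteDimensional (ZMod 2) V] (N : ℕ) : ∀ (D : L → Finset V), (∑ l, (D l).card ≤ N) →
    (∀ T : Finset L, Module.finrank (ZMod 2) V ≤ T.card +
      Module.finrank (ZMod 2) (Submodule.span (ZMod 2) {x | ∃ l, l ∉ T ∧ x ∈ D l})) →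
    ∃ v : L → V, (∀ l, v l ∈ D l ∨ v l = 0) ∧ Submodule.span (ZMod 2) (Set.range v) = ⊤ := by
  induction N with
  | zero =>
    intro D hD h
    have hD' : ∀ l, D l = ∅ := by
      intro l
      have := Finset.single_le_sum (f := fun l => (D l).card) (fun _ _ => Nat.zero_le _)
        (Finset.mem_univ l)
      exact Finset.card_eq_zero.1 (by omega)
    refine ⟨fun _ => 0, fun _ => Or.inr rfl, ?_⟩
    have h0 := h ∅
    apply Submodule.eq_top_of_finrank_eq
    apply le_antisymm (Submodule.finrank_le _)
    simp only [Finset.card_empty, zero_add] at h0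
    refine h0.trans (Submodule.finrank_mono (Submodule.span_mono ?_))
    rintro w ⟨i, -, hw⟩
    simp [hD'] at hw
  | succ N ih =>
    intro D hD h
    by_cases hc : ∃ l, ∃ x ∈ D l, ∃ y ∈ D l, x ≠ y
    · obtain ⟨l, x, hx, y, hy, hxy⟩ := hc
      have step : ∀ z ∈ D l, (∀ T : Finset L, Module.finrank (ZMod 2) V ≤ T.card +
          Module.finrank (ZMod 2) (Submodule.span (ZMod 2)
            {x | ∃ i, i ∉ T ∧ x ∈ Function.update D l ((D l).erase z) i})) →
          ∃ v : L → V, (∀ l, v l ∈ D l ∨ v l = 0) ∧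
            Submodule.span (ZMod 2) (Set.range v) = ⊤ := by
        intro z hz hT
        obtain ⟨v, hv, hs⟩ := ih (Function.update D l ((D l).erase z)) (by
          have : ∑ i, (Function.update D l ((D l).erase z) i).card < ∑ i, (D i).card := by
            apply Finset.sum_lt_sum
            · intro i _
              by_cases hi : i = l
              · subst hi; simpa using Finset.card_erase_le
              · simp [hi]
            · refine ⟨l, Finset.mem_univ _, ?_⟩
              simpa using Finset.card_erase_lt_of_mem hz
          omega) hT
        refine ⟨v, fun i => ?_, hs⟩
        rcases hv i with h1 | h1
        · left
          by_cases hi : i = l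
          · subst hi; simp at h1; exact h1.2
          · simpa [hi] using h1
        · exact Or.inr h1
      by_contra hno
      have hx' := mt (step x hx) hno
      have hy' := mt (step y hy) hno
      push Not at hx' hy'
      obtain ⟨T, hT⟩ := hx'
      obtain ⟨T', hT'⟩ := hy'
      have mem : ∀ (z : V) (S : Finset L), S.card + Module.finrank (ZMod 2) (Submodule.span (ZMod 2)
            {x | ∃ i, i ∉ S ∧ x ∈ Function.update D l ((D l).erase z) i}) <
            Module.finrank (ZMod 2) V → l ∉ S := by
        intro z S hS hl
        have : {x | ∃ i, i ∉ S ∧ x ∈ Function.update D l ((D l).erase z) i} =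
            {x | ∃ i, i ∉ S ∧ x ∈ D i} := by
          ext w
          constructor
          · rintro ⟨i, hi, hw⟩
            have : i ≠ l := fun h => hi (h ▸ hl)
            exact ⟨i, hi, by simpa [this] using hw⟩
          · rintro ⟨i, hi, hw⟩
            have : i ≠ l := fun h => hi (h ▸ hl)
            exact ⟨i, hi, by simpa [this] using hw⟩
        rw [this] at hS
        exact absurd (h S) (by omega)
      have hlT := mem x T hT
      have hlT' := mem y T' hT'
      set X := Submodule.span (ZMod 2)
            {w | ∃ i, i ∉ T ∧ w ∈ Function.update D l ((D l).erase x) i} with hX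
      set Y := Submodule.span (ZMod 2)
            {w | ∃ i, i ∉ T' ∧ w ∈ Function.update D l ((D l).erase y) i} with hY
      have hsub := Submodule.finrank_sup_add_finrank_inf_eq X Y
      have h1 : Submodule.span (ZMod 2) {w | ∃ i, i ∉ T ∩ T' ∧ w ∈ D i} ≤ X ⊔ Y := by
        rw [Submodule.span_le]
        rintro w ⟨i, hi, hw⟩
        by_cases hil : i = l
        · subst hil
          by_cases hwx : w = x
          · refine Submodule.mem_sup_right (Submodule.subset_span ⟨i, hlT', ?_⟩)
            simp [hw, hwx, hxy]
            exact hx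
          · refine Submodule.mem_sup_left (Submodule.subset_span ⟨i, hlT, ?_⟩)
            simp [hw, hwx]
        · rw [Finset.mem_inter, not_and_or] at hi
          rcases hi with hi | hi
          · exact Submodule.mem_sup_left (Submodule.subset_span ⟨i, hi, by simpa [hil] using hw⟩)
          · exact Submodule.mem_sup_right (Submodule.subset_span ⟨i, hi, by simpa [hil] using hw⟩)
      have h2 : Submodule.span (ZMod 2) {w | ∃ i, i ∉ insert l (T ∪ T') ∧ w ∈ D i} ≤ X ⊓ Y := by
        rw [Submodule.span_le]
        rintro w ⟨i, hi, hw⟩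
        simp only [Finset.mem_insert, Finset.mem_union, not_or] at hi
        obtain ⟨hil, hi1, hi2⟩ := hi
        exact ⟨Submodule.subset_span ⟨i, hi1, by simpa [hil] using hw⟩,
          Submodule.subset_span ⟨i, hi2, by simpa [hil] using hw⟩⟩
      have h1' := Submodule.finrank_mono h1
      have h2' := Submodule.finrank_mono h2
      have c1 := h (T ∩ T')
      have c2 := h (insert l (T ∪ T'))
      rw [Finset.card_insert_of_notMem (by simp [hlT, hlT'])] at c2
      have c3 := Finset.card_union_add_card_inter T T'
      omega
    · push Not at hc
      have : ∀ l, ∃ v, (v ∈ D l ∨ v = 0) ∧ ∀ x ∈ D l, x = v := by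
        intro l
        by_cases hl : ∃ x, x ∈ D l
        · obtain ⟨x, hx⟩ := hl
          exact ⟨x, Or.inl hx, fun y hy => hc l y hy x hx⟩
        · exact ⟨0, Or.inr rfl, fun y hy => absurd ⟨y, hy⟩ hl⟩
      choose v hv hv' using this
      refine ⟨v, hv, ?_⟩
      apply Submodule.eq_top_of_finrank_eq
      apply le_antisymm (Submodule.finrank_le _)
      have h0 := h ∅
      simp only [Finset.card_empty, zero_add] at h0
      refine h0.trans (Submodule.finrank_mono (Submodule.span_mono ?_))
      rintro w ⟨i, -, hw⟩
      exact ⟨i, (hv' i w hw).symm⟩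

theorem exists_decomp (f : Op A) : ∃ d, ∃ s φ, IsDecomp (B A 1) f d s φ := by
  refine ⟨f.1, f.2, fun i a => a i, fun i => ?_, fun a => rfl⟩
  exact B1_unary i id

theorem degC_le (C : Set (Op A)) (f : Op A) {d : ℕ} {s φ} (h : IsDecomp C f d s φ) :
    degC C f ≤ d := by
  unfold degC
  split_ifs
  · exact Nat.zero_le _
  · exact Nat.sInf_le ⟨s, φ, h⟩

theorem degC_eq (C : Set (Op A)) (f : Op A) {d : ℕ} {s φ} (h : IsMinDecomp C f d s φ) :
    degC C f = d := by
  apply le_antisymm (degC_le C f h.1)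
  unfold degC
  split_ifs with hc
  · obtain ⟨c, hc⟩ := hc
    exact h.2 0 (fun _ => c) (fun i => i.elim0) ⟨fun i => i.elim0, hc⟩
  · have : sInf {d : ℕ | ∃ g φ, IsDecomp C f d g φ} ∈ {d : ℕ | ∃ g φ, IsDecomp C f d g φ} :=
      Nat.sInf_mem ⟨d, s, φ, h.1⟩
    obtain ⟨s', φ', h'⟩ := this
    exact h.2 _ s' φ' h'

theorem exists_minDecomp (f : Op A) : ∃ d, ∃ s φ, IsMinDecomp (B A 1) f d s φ := by
  classical
  have h := exists_decomp f
  obtain ⟨s, φ, hs⟩ := Nat.find_spec h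
  exact ⟨Nat.find h, s, φ, hs, fun d' s' φ' h' => Nat.find_min' h ⟨s', φ', h'⟩⟩

/-- Factoring through any finite family from `B_1` bounds the minimal degree. -/
theorem min_le_card [Nonempty A] {n d : ℕ} {f : (Fin n → A) → A} {s ψ}
    (hmin : IsMinDecomp (B A 1) ⟨n, f⟩ d s ψ) {ι : Type*} [Fintype ι]
    (θ : ι → (Fin n → A) → A) (hθ : ∀ i, (⟨n, θ i⟩ : Op A) ∈ B A 1)
    (hf : ∀ a b, (∀ i, θ i a = θ i b) → f a = f b) : d ≤ Fintype.card ι := by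
  have e := Fintype.equivFin ι
  have hfac : Function.FactorsThrough f (fun a => fun j => θ (e.symm j) a) := by
    intro a b hab
    apply hf
    intro i
    have := congrFun hab (e i)
    simpa using this
  obtain ⟨s', hs'⟩ := (Function.factorsThrough_iff _).1 hfac
  refine hmin.2 (Fintype.card ι) s' (fun j => θ (e.symm j)) ⟨fun j => hθ _, fun a => ?_⟩
  exact congrFun hs' a

theorem rank_cond [Nontrivial A] {n d : ℕ} {f : (Fin n → A) → A} {s ψ}
    (hmin : IsMinDecomp (B A 1) ⟨n, f⟩ d s ψ)
    {P Q : Type*} [Fintype Q] (pi : P → Fin d) (qi : Q → Fin d)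
    (hpq : ∀ i, (∃ p, pi p = i) ∨ ∃ q, qi q = i)
    (σ : P → Fin n) (u : P → A → A) (hu : ∀ p a, ψ (pi p) a = u p (a (σ p)))
    (H : Q → Fin n → A → ZMod 2) (G : Q → ZMod 2 → A)
    (hG : ∀ q a, ψ (qi q) a = G q (∑ l, H q l (a l))) (a0 : A)
    (T : Finset (Fin n)) (hT : ∀ p, σ p ∈ T) :
    d ≤ T.card + Module.finrank (ZMod 2) (Submodule.span (ZMod 2)
      {x : Q → ZMod 2 | ∃ l, l ∉ T ∧ ∃ b, x = fun q => H q l b - H q l a0}) := by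
  classical
  set U := Submodule.span (ZMod 2)
      {x : Q → ZMod 2 | ∃ l, l ∉ T ∧ ∃ b, x = fun q => H q l b - H q l a0} with hU
  obtain ⟨p0, q0, hne⟩ := exists_pair_ne A
  let emb : ZMod 2 → A := fun z => if z = 0 then p0 else q0
  have hemb : Function.Injective emb := by
    intro z w h
    have hz : z = 0 ∨ z = 1 := by clear h; revert z; decide
    have hw : w = 0 ∨ w = 1 := by clear h; revert w; decide
    rcases hz with rfl | rfl <;> rcases hw with rfl | rfl <;> simp_all [emb, eq_comm]
  let e : U ≃ₗ[ZMod 2] (Fin (Module.finrank (ZMod 2) U) → ZMod 2) :=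
    LinearEquiv.ofFinrankEq _ _ (by simp)
  let K : Fin n → A → U := fun l b =>
    if hl : l ∉ T then ⟨fun q => H q l b - H q l a0, Submodule.subset_span ⟨l, hl, b, rfl⟩⟩ else 0
  have hle := min_le_card hmin (ι := T ⊕ Fin (Module.finrank (ZMod 2) U))
    (Sum.elim (fun l a => a l) (fun j a => emb (∑ l, e (K l (a l)) j))) (by
      rintro (l | j)
      · exact B1_unary l.1 id
      · exact B1_aff emb (aff_sum Finset.univ (fun l a => e (K l (a l)) j)
          (fun l _ => aff_unary l (fun b => e (K l b) j)))) (by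
      intro a b hab
      have h1 : ∀ l ∈ T, a l = b l := fun l hl => hab (Sum.inl ⟨l, hl⟩)
      have h2 : ∑ l, K l (a l) = ∑ l, K l (b l) := by
        apply e.injective
        funext j
        have := hemb (hab (Sum.inr j))
        simpa [map_sum] using this
      have ha := hmin.1.2 a
      have hb := hmin.1.2 b
      simp only at ha hb
      rw [ha, hb]
      congr 1
      funext i
      rcases hpq i with ⟨p, rfl⟩ | ⟨q, rfl⟩
      · rw [hu, hu, h1 _ (hT p)]
      · rw [hG, hG]
        congr 1
        have h3 : ∑ l, (K l (a l)).1 q = ∑ l, (K l (b l)).1 q := by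
          have := congrFun (congrArg Subtype.val h2) q
          simpa using this
        rw [← sub_eq_zero, ← Finset.sum_sub_distrib] at h3 ⊢
        rw [← h3]
        apply Finset.sum_congr rfl
        intro l _
        by_cases hl : l ∈ T
        · simp [h1 l hl]
        · simp [K, hl])
  simpa using hle

theorem key [Nontrivial A] [Fintype A] {n m d : ℕ} {f : (Fin n → A) → A} {s ψ}
    (hmin : IsMinDecomp (B A 1) ⟨n, f⟩ d s ψ) (φ : Fin d → (Fin m → A) → A)
    (hφ : ∀ i, (⟨m, φ i⟩ : Op A) ∈ B A 1) (hr : ∀ i x, ∃ y, ψ i y = φ i x) :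
    ∃ t : Fin n → (Fin m → A) → A, (∀ l, (⟨m, t l⟩ : Op A) ∈ B A 1) ∧
      ∀ i x, ψ i (fun l => t l x) = φ i x := by
  classical
  obtain ⟨a0⟩ : Nonempty A := inferInstance
  let Q := {i : Fin d // Quasilinear (⟨n, ψ i⟩ : Op A)}
  let P := {i : Fin d // ¬ Quasilinear (⟨n, ψ i⟩ : Op A)}
  have hP : ∀ p : P, ∃ (l : Fin n) (u : A → A), ∀ a, ψ p.1 a = u (a l) := fun p =>
    (B1_cases (hmin.1.1 p.1)).resolve_left p.2
  choose σ u hu using hP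
  have hQ : ∀ q : Q, ∃ (h : Fin n → A → ZMod 2) (g : ZMod 2 → A),
      ∀ a, ψ q.1 a = g (∑ l, h l (a l)) := fun q => q.2
  choose H G hG using hQ
  have rk := rank_cond hmin (P := P) (Q := Q) Subtype.val Subtype.val
    (fun i => (Classical.em (Quasilinear (⟨n, ψ i⟩ : Op A))).elim
      (fun h => Or.inr ⟨⟨i, h⟩, rfl⟩) (fun h => Or.inl ⟨⟨i, h⟩, rfl⟩)) σ u hu H G hG a0
  have hcard : Fintype.card P + Fintype.card Q = d := by
    have := Fintype.card_subtype_compl (fun i : Fin d => Quasilinear (⟨n, ψ i⟩ : Op A))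
    have h2 := Fintype.card_subtype_le (fun i : Fin d => Quasilinear (⟨n, ψ i⟩ : Op A))
    simp only [Fintype.card_fin] at this h2
    change Fintype.card P = d - Fintype.card Q at this
    change Fintype.card Q ≤ d at h2
    omega
  let S : Finset (Fin n) := Finset.univ.image σ
  have hS : ∀ p, σ p ∈ S := fun p => Finset.mem_image_of_mem _ (Finset.mem_univ p)
  have hSle : S.card ≤ Fintype.card P := Finset.card_image_le
  have hσ : Function.Injective σ := by
    have h1 := rk S hS
    have h2 := Submodule.finrank_le (Submodule.span (ZMod 2)
      {x : Q → ZMod 2 | ∃ l, l ∉ S ∧ ∃ b, x = fun q => H q l b - H q l a0})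
    rw [Module.finrank_fintype_fun_eq_card] at h2
    have h3 : (Finset.univ.image σ).card = (Finset.univ : Finset P).card := by
      rw [Finset.card_univ]
      change S.card = _
      omega
    have h4 := Finset.card_image_iff.1 h3
    simpa using h4
  let D : Fin n → Finset (Q → ZMod 2) := fun l =>
    if l ∈ S then ∅ else Finset.univ.image (fun b => fun q => H q l b - H q l a0)
  obtain ⟨v, hv, hspan⟩ := rado _ D le_rfl (by
    intro T
    rw [Module.finrank_fintype_fun_eq_card]
    have h1 := rk (S ∪ T) (fun p => Finset.mem_union_left _ (hS p))
    have h2 := Finset.card_union_le S T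
    have h3 : Submodule.span (ZMod 2)
      {x : Q → ZMod 2 | ∃ l, l ∉ S ∪ T ∧ ∃ b, x = fun q => H q l b - H q l a0} ≤
      Submodule.span (ZMod 2) {x | ∃ l, l ∉ T ∧ x ∈ D l} := by
      apply Submodule.span_mono
      rintro x ⟨l, hl, b, rfl⟩
      simp only [Finset.mem_union, not_or] at hl
      exact ⟨l, hl.2, by simp [D, hl.1]⟩
    have h4 := Submodule.finrank_mono h3
    omega)
  have hv' : ∀ l, ∃ b : A, v l = (fun q => H q l b - H q l a0) ∧ (l ∈ S → v l = 0) := by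
    intro l
    rcases hv l with h | h
    · by_cases hl : l ∈ S
      · simp [D, hl] at h
      · simp only [D, hl, if_false, Finset.mem_image] at h
        obtain ⟨b, -, hb⟩ := h
        exact ⟨b, hb.symm, fun h => absurd h hl⟩
    · exact ⟨a0, by rw [h]; funext q; simp, fun _ => h⟩
  choose E hE hE0 using hv'
  have hsurj : Function.Surjective (Fintype.linearCombination (ZMod 2) v) := by
    rw [← LinearMap.range_eq_top, Fintype.range_linearCombination, hspan]
  obtain ⟨M, hM⟩ := (Fintype.linearCombination (ZMod 2) v).exists_rightInverse_of_surjective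
    (LinearMap.range_eq_top.2 hsurj)
  -- affine forms for the target
  have hL : ∀ q : Q, ∃ L ∈ Aff A m, ∀ x, φ q.1 x = G q (L x) := fun q =>
    aff_lift (hφ q.1) (G q) (fun x => by
      obtain ⟨y, hy⟩ := hr q.1 x
      exact ⟨_, (hG q y).symm.trans hy⟩)
  choose μ hμ hμφ using hL
  -- base values
  have hW : ∀ p : P, ∃ w : A → A, ∀ x, u p (w (φ p.1 x)) = φ p.1 x := fun p =>
    ⟨Function.invFun (u p), fun x => Function.invFun_eq (by
      obtain ⟨y, hy⟩ := hr p.1 x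
      exact ⟨_, (hu p y).symm.trans hy⟩)⟩
  choose w hw using hW
  let base : Fin n → (Fin m → A) → A := fun l x =>
    if h : ∃ p, σ p = l then w h.choose (φ h.choose.1 x) else a0
  have hbase : ∀ p x, base (σ p) x = w p (φ p.1 x) := by
    intro p x
    have h : ∃ p', σ p' = σ p := ⟨p, rfl⟩
    have : h.choose = p := hσ h.choose_spec
    simp only [base, dif_pos h]
    rw [this]
  have hbase0 : ∀ l, l ∉ S → ∀ x, base l x = a0 := by
    intro l hl x
    have : ¬ ∃ p, σ p = l := by rintro ⟨p, rfl⟩; exact hl (hS p)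
    simp only [base, dif_neg this]
  have hbaseB : ∀ l, (⟨m, base l⟩ : Op A) ∈ B A 1 := by
    intro l
    by_cases h : ∃ p, σ p = l
    · obtain ⟨p, rfl⟩ := h
      have : base (σ p) = fun x => w p (φ p.1 x) := funext (hbase p)
      rw [this]
      exact B1_post (hφ p.1) (w p)
    · have : base l = fun _ => a0 := by
        funext x; simp only [base, dif_neg h]
      rw [this]
      exact Or.inr (quasi_const m a0)
  let R : (Fin m → A) → Q → ZMod 2 := fun x q => μ q x - ∑ l, H q l (base l x)
  have hR : ∀ q, (fun x => R x q) ∈ Aff A m := fun q =>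
    Submodule.sub_mem _ (hμ q) (aff_sum Finset.univ (fun l x => H q l (base l x))
      (fun l _ => aff_post (hbaseB l) (H q l)))
  have hc : ∀ l, (fun x => M (R x) l) ∈ Aff A m := by
    intro l
    have : (fun x => M (R x) l) = fun x => ∑ q, (M (Pi.single q 1) l • fun x => R x q) x := by
      funext x
      conv_lhs => rw [pi_eq_sum_univ' (R x)]
      simp [map_sum, mul_comm]
    rw [this]
    exact aff_sum Finset.univ (fun q => M (Pi.single q 1) l • fun x => R x q)
      (fun q _ => Submodule.smul_mem _ _ (hR q))
  refine ⟨fun l => if l ∈ S then base l else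
    fun x => (fun z : ZMod 2 => if z = 0 then a0 else E l) (M (R x) l), ?_, ?_⟩
  · intro l
    by_cases hl : l ∈ S
    · simp only [hl, if_true]; exact hbaseB l
    · simp only [hl, if_false]
      exact B1_aff (fun z : ZMod 2 => if z = 0 then a0 else E l) (hc l)
  · intro i x
    by_cases hi : Quasilinear (⟨n, ψ i⟩ : Op A)
    · rw [hG ⟨i, hi⟩, hμφ ⟨i, hi⟩]
      congr 1
      have h1 := congrFun (LinearMap.congr_fun hM (R x)) ⟨i, hi⟩
      simp only [LinearMap.comp_apply, LinearMap.id_apply, Fintype.linearCombination_apply,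
        Finset.sum_apply, Pi.smul_apply, smul_eq_mul] at h1
      have h2 : μ ⟨i, hi⟩ x = ∑ l, (H ⟨i, hi⟩ l (base l x) + M (R x) l * v l ⟨i, hi⟩) := by
        rw [Finset.sum_add_distrib, h1]
        simp [R]
      rw [h2]
      apply Finset.sum_congr rfl
      intro l _
      by_cases hl : l ∈ S
      · simp [hl, hE0 l hl]
      · have hz : M (R x) l = 0 ∨ M (R x) l = 1 := by
          generalize M (R x) l = z
          revert z; decide
        rw [hbase0 l hl, hE l]
        rcases hz with hz | hz <;> simp [hl, hz]
    · rw [hu ⟨i, hi⟩]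
      simp only [hS, if_true]
      rw [hbase, hw]

/-- If `f ⊑_{B_1} g` with equal `B_1`-degrees and equal `B_1`-range degrees, then
`f ≡_{B_1} g`. -/
theorem equiv_of_subfn_eq_deg_B1 (k : ℕ) (hk : 2 ≤ k) (f g : Op (Fin k))
    (hsub : Subfn (B (Fin k) 1) f g)
    (hdeg : degC (B (Fin k) 1) f = degC (B (Fin k) 1) g)
    (hdegr : degrC (B (Fin k) 1) f = degrC (B (Fin k) 1) g) :
    EquivC (B (Fin k) 1) f g := by
  haveI : Nontrivial (Fin k) := Fin.nontrivial_iff_two_le.2 hk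
  refine ⟨hsub, ?_⟩
  obtain ⟨m, g⟩ := g
  obtain ⟨n, f⟩ := f
  obtain ⟨h, hh, hfg⟩ := hsub
  have hne : {r : ℕ | ∃ (d : ℕ) (s : (Fin d → Fin k) → Fin k)
      (φ : Fin d → (Fin m → Fin k) → Fin k),
      IsMinDecomp (B (Fin k) 1) ⟨m, g⟩ d s φ ∧ (tupleRange φ).ncard = r}.Nonempty := by
    obtain ⟨d, s, φ, hd⟩ := exists_minDecomp (⟨m, g⟩ : Op (Fin k))
    exact ⟨_, d, s, φ, hd, rfl⟩
  obtain ⟨d, s, φ, hmin, hcard⟩ := Nat.sInf_mem hne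
  change _ = degrC (B (Fin k) 1) ⟨m, g⟩ at hcard
  let ψ : Fin d → (Fin n → Fin k) → Fin k := fun i a => φ i (fun j => h j a)
  have hψ : IsMinDecomp (B (Fin k) 1) ⟨n, f⟩ d s ψ := by
    refine ⟨⟨fun i => B1_comp (hmin.1.1 i) hh, fun a => ?_⟩, fun d' s' φ' h' => ?_⟩
    · exact (hfg a).trans (hmin.1.2 _)
    · rw [← degC_eq _ _ hmin, ← hdeg]
      exact degC_le _ _ h'
  have hsubset : tupleRange ψ ⊆ tupleRange φ := by
    rintro _ ⟨a, rfl⟩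
    exact ⟨fun j => h j a, rfl⟩
  have hle : (tupleRange φ).ncard ≤ (tupleRange ψ).ncard := by
    rw [hcard, ← hdegr]
    exact Nat.sInf_le ⟨d, s, ψ, hψ, rfl⟩
  have heq := Set.eq_of_subset_of_ncard_le hsubset hle (Set.toFinite _)
  obtain ⟨t, ht, htφ⟩ := key hψ φ hmin.1.1 (fun i x => by
    have : (fun i => φ i x) ∈ tupleRange ψ := by rw [heq]; exact ⟨x, rfl⟩
    obtain ⟨y, hy⟩ := this
    exact ⟨y, congrFun hy i⟩)
  refine ⟨t, ht, fun x => ?_⟩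
  refine (hmin.1.2 x).trans (Eq.symm ((hψ.1.2 _).trans ?_))
  congr 1
  funext i
  exact htφ i x

end PaperSubfn
end
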